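/- Let Ψ : (0,1] → (0,∞) be decreasing such that s ↦ sΨ(s) is increasing on (0,1], with the normalization ∫₀¹ ds/(sΨ(s)) = 1. Then there exists a constant c = c(Ψ) > 0 such that the following holds. Let n ≥ 1, let α₁,…,αₙ ≥ 0 with Σ_{k=1}^n α_k = 1, let f₁,…,fₙ ∈ ℝ, and let N₁,…,Nₙ be distribution functions with ∫₀^∞ N_k(t) dt > 0 for each k. Set f = Σ_{k=1}^n α_k f_k and N = Σ_{k=1}^n α_k N_k. Then −B̃(f, N) + Σ_{k=1}^n α_k B̃(f_k, N_k) ≥ (c/16)·(Σ_{k=1}^n α_k |f_k − f|)² / n_Ψ(N), where if n_Ψ(N) = ∞ the right-hand side is interpreted as 0. -/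

import Mathlib

open MeasureTheory

/-- `n_Ψ(N) = ∫₀^∞ N(t)Ψ(N(t)) dt`, integrand taken to be `0` where `N(t) = 0`.
(The Bochner integral is `0` when the integrand is not integrable, which implements the
convention that the right-hand side below is `0` when `n_Ψ(N) = ∞`.) -/
noncomputable def nPsi (Ψ N : ℝ → ℝ) : ℝ :=
  ∫ t in Set.Ioi (0:ℝ), (if N t = 0 then 0 else N t * Ψ (N t))

/-- `m(s) = ∫₀^s (s−σ)/φ(σ) dσ` where `φ(σ) = σΨ(σ)`. -/
noncomputable def mFun (Ψ : ℝ → ℝ) (s : ℝ) : ℝ :=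
  ∫ σ in Set.Ioo (0:ℝ) s, (s - σ) / (σ * Ψ σ)

/-- `u(N) = ∫₀^∞ (2N(t) − m(N(t))) dt`. -/
noncomputable def uFun (Ψ N : ℝ → ℝ) : ℝ :=
  ∫ t in Set.Ioi (0:ℝ), (2 * N t - mFun Ψ (N t))

/-- The Bellman function `B̃(f, N) = f²/u(N)`. -/
noncomputable def Btilde (Ψ : ℝ → ℝ) (f : ℝ) (N : ℝ → ℝ) : ℝ := f ^ 2 / uFun Ψ N

/-- A distribution function: decreasing `N : [0,∞) → [0,1]` with `∫₀^∞ N < ∞`. -/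
def IsDistFun (N : ℝ → ℝ) : Prop :=
  AntitoneOn N (Set.Ici 0) ∧ (∀ t, 0 ≤ t → N t ∈ Set.Icc (0:ℝ) 1) ∧
    MeasureTheory.IntegrableOn N (Set.Ioi 0)

open Set

section Convexity

variable {Ψ : ℝ → ℝ}

lemma integrableOn_posPart_mul {w : ℝ → ℝ} (hw : IntegrableOn w (Ioo 0 1)) (s : ℝ) :
    IntegrableOn (fun σ => max (s - σ) 0 * w σ) (Ioo 0 1) := by
  refine Integrable.bdd_mul (c := |s| + 1) hw (by fun_prop) ?_
  filter_upwards [ae_restrict_mem measurableSet_Ioo] with σ hσ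
  rw [Real.norm_eq_abs, abs_of_nonneg (le_max_right _ _)]
  refine max_le ?_ (by positivity)
  linarith [le_abs_self s, hσ.1]

lemma mFun_eq_integral_posPart {s : ℝ} (hs : s ∈ Icc (0 : ℝ) 1) :
    mFun Ψ s = ∫ σ in Ioo (0 : ℝ) 1, max (s - σ) 0 * (σ * Ψ σ)⁻¹ := by
  rw [mFun, setIntegral_congr_fun (g := fun σ => max (s - σ) 0 * (σ * Ψ σ)⁻¹) measurableSet_Ioo]
  · symm
    refine setIntegral_eq_of_subset_of_forall_sdiff_eq_zero measurableSet_Ioo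
      (Ioo_subset_Ioo_right hs.2) ?_
    rintro σ ⟨h1, h2⟩
    have : s ≤ σ := by
      by_contra! h
      exact h2 ⟨h1.1, h⟩
    simp [max_eq_right (sub_nonpos.2 this)]
  · intro σ hσ
    simp only [max_eq_left (sub_nonneg.2 hσ.2.le), div_eq_mul_inv]

lemma mFun_zero : mFun Ψ 0 = 0 := by simp [mFun]

lemma integrableOn_inv_of_norm (hnorm : (∫ s in Ioo (0 : ℝ) 1, (s * Ψ s)⁻¹) = 1) :
    IntegrableOn (fun s => (s * Ψ s)⁻¹) (Ioo (0 : ℝ) 1) := by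
  by_contra h
  rw [integral_undef h] at hnorm
  exact zero_ne_one hnorm

lemma inv_nonneg_of_pos (hpos : ∀ s ∈ Ioc (0 : ℝ) 1, 0 < Ψ s)
    {σ : ℝ} (hσ : σ ∈ Ioo (0 : ℝ) 1) : 0 ≤ (σ * Ψ σ)⁻¹ :=
  (inv_pos.2 (mul_pos hσ.1 (hpos σ ⟨hσ.1, hσ.2.le⟩))).le

lemma mFun_mono (hpos : ∀ s ∈ Ioc (0 : ℝ) 1, 0 < Ψ s)
    (hnorm : (∫ s in Ioo (0 : ℝ) 1, (s * Ψ s)⁻¹) = 1)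
    {x y : ℝ} (hx : x ∈ Icc (0 : ℝ) 1) (hy : y ∈ Icc (0 : ℝ) 1) (h : y ≤ x) :
    mFun Ψ y ≤ mFun Ψ x := by
  have hw := integrableOn_inv_of_norm hnorm
  rw [mFun_eq_integral_posPart hx, mFun_eq_integral_posPart hy]
  refine setIntegral_mono_on (integrableOn_posPart_mul hw y) (integrableOn_posPart_mul hw x)
    measurableSet_Ioo fun σ hσ => ?_
  have := inv_nonneg_of_pos hpos hσ
  gcongr

lemma mFun_sub_le (hpos : ∀ s ∈ Ioc (0 : ℝ) 1, 0 < Ψ s)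
    (hnorm : (∫ s in Ioo (0 : ℝ) 1, (s * Ψ s)⁻¹) = 1)
    {x y : ℝ} (hx : x ∈ Icc (0 : ℝ) 1) (hy : y ∈ Icc (0 : ℝ) 1) (h : y ≤ x) :
    mFun Ψ x - mFun Ψ y ≤ x - y := by
  have hw := integrableOn_inv_of_norm hnorm
  rw [mFun_eq_integral_posPart hx, mFun_eq_integral_posPart hy,
    ← integral_sub (integrableOn_posPart_mul hw x) (integrableOn_posPart_mul hw y)]
  calc _ ≤ ∫ σ in Ioo (0 : ℝ) 1, (x - y) * (σ * Ψ σ)⁻¹ := by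
        refine setIntegral_mono_on
          ((integrableOn_posPart_mul hw x).sub (integrableOn_posPart_mul hw y))
          (hw.const_mul _) measurableSet_Ioo fun σ hσ => ?_
        rw [← sub_mul]
        refine mul_le_mul_of_nonneg_right ?_ (inv_nonneg_of_pos hpos hσ)
        rcases max_cases (x - σ) 0 with h1 | h1 <;> rcases max_cases (y - σ) 0 with h2 | h2 <;>
          linarith
    _ = x - y := by rw [integral_const_mul, hnorm, mul_one]

lemma mFun_nonneg (hpos : ∀ s ∈ Ioc (0 : ℝ) 1, 0 < Ψ s)
    (hnorm : (∫ s in Ioo (0 : ℝ) 1, (s * Ψ s)⁻¹) = 1)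
    {x : ℝ} (hx : x ∈ Icc (0 : ℝ) 1) : 0 ≤ mFun Ψ x :=
  mFun_zero (Ψ := Ψ) ▸ mFun_mono hpos hnorm hx (by simp) hx.1

lemma mFun_le_self (hpos : ∀ s ∈ Ioc (0 : ℝ) 1, 0 < Ψ s)
    (hnorm : (∫ s in Ioo (0 : ℝ) 1, (s * Ψ s)⁻¹) = 1)
    {x : ℝ} (hx : x ∈ Icc (0 : ℝ) 1) : mFun Ψ x ≤ x := by
  have := mFun_sub_le hpos hnorm hx (y := 0) (by simp) hx.1
  simpa [mFun_zero] using this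

lemma abs_sub_mFun_le (hpos : ∀ s ∈ Ioc (0 : ℝ) 1, 0 < Ψ s)
    (hnorm : (∫ s in Ioo (0 : ℝ) 1, (s * Ψ s)⁻¹) = 1)
    {x y : ℝ} (hx : x ∈ Icc (0 : ℝ) 1) (hy : y ∈ Icc (0 : ℝ) 1) :
    |(2 * x - mFun Ψ x) - (2 * y - mFun Ψ y)| ≤ 2 * |x - y| := by
  rcases le_total y x with h | h
  · have h1 := mFun_mono hpos hnorm hx hy h
    have h2 := mFun_sub_le hpos hnorm hx hy h
    rw [abs_of_nonneg (sub_nonneg.2 h), abs_le]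
    constructor <;> linarith
  · have h1 := mFun_mono hpos hnorm hy hx h
    have h2 := mFun_sub_le hpos hnorm hy hx h
    rw [abs_of_nonpos (sub_nonpos.2 h), abs_le]
    constructor <;> linarith

/-- Strong convexity of `m` to the left of `x`, in subgradient form. -/
lemma exists_subgradient_mFun (hpos : ∀ s ∈ Ioc (0 : ℝ) 1, 0 < Ψ s)
    (hnorm : (∫ s in Ioo (0 : ℝ) 1, (s * Ψ s)⁻¹) = 1)
    (hinc : MonotoneOn (fun s => s * Ψ s) (Ioc (0 : ℝ) 1))
    {x : ℝ} (hx : x ∈ Ioc (0 : ℝ) 1) :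
    ∃ p : ℝ, ∀ y ∈ Icc (0 : ℝ) 1,
      (max (x - y) 0) ^ 2 / (2 * (x * Ψ x)) ≤ mFun Ψ y - mFun Ψ x - p * (y - x) := by
  have hw := integrableOn_inv_of_norm hnorm
  have hI : IntegrableOn ((Iio x).indicator fun σ => (σ * Ψ σ)⁻¹) (Ioo (0 : ℝ) 1) :=
    hw.indicator measurableSet_Iio
  refine ⟨∫ σ in Ioo (0 : ℝ) 1, (Iio x).indicator (fun σ => (σ * Ψ σ)⁻¹) σ, fun y hy => ?_⟩
  have hφ : 0 < x * Ψ x := mul_pos hx.1 (hpos x hx)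
  rw [mFun_eq_integral_posPart hy, mFun_eq_integral_posPart (Ioc_subset_Icc_self hx),
    ← integral_sub (integrableOn_posPart_mul hw y) (integrableOn_posPart_mul hw x),
    ← integral_mul_const]
  refine le_of_le_of_eq ?_ (integral_sub
    ((integrableOn_posPart_mul hw y).sub (integrableOn_posPart_mul hw x)) (hI.mul_const _))
  set F : ℝ → ℝ := fun σ => max (y - σ) 0 * (σ * Ψ σ)⁻¹ - max (x - σ) 0 * (σ * Ψ σ)⁻¹ -
    (Iio x).indicator (fun σ => (σ * Ψ σ)⁻¹) σ * (y - x) with hF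
  have hFint : IntegrableOn F (Ioo (0 : ℝ) 1) :=
    ((integrableOn_posPart_mul hw y).sub (integrableOn_posPart_mul hw x)).sub (hI.mul_const _)
  have hlt : ∀ σ ∈ Ioo (0 : ℝ) 1, σ < x → F σ = max (σ - y) 0 * (σ * Ψ σ)⁻¹ := by
    intro σ hσ h
    have h1 : max (x - σ) 0 = x - σ := max_eq_left (by linarith)
    have h2 : max (σ - y) 0 = max (y - σ) 0 - (y - σ) := by
      rcases max_cases (σ - y) 0 with h1 | h1 <;> rcases max_cases (y - σ) 0 with h2 | h2 <;>
        linarith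
    simp only [hF, indicator_of_mem (mem_Iio.2 h), h1, h2]
    ring
  have hnn : ∀ σ ∈ Ioo (0 : ℝ) 1, 0 ≤ F σ := by
    intro σ hσ
    have h0 := inv_nonneg_of_pos hpos hσ
    rcases lt_or_ge σ x with h | h
    · rw [hlt σ hσ h]
      positivity
    · have h1 : max (x - σ) 0 = 0 := max_eq_right (by linarith)
      simp only [hF, indicator_of_notMem (notMem_Iio.2 h), h1, zero_mul, sub_zero]
      positivity
  rcases le_total x y with hxy | hxy
  · rw [max_eq_right (sub_nonpos.2 hxy)]
    simpa using setIntegral_nonneg measurableSet_Ioo hnn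
  rw [max_eq_left (sub_nonneg.2 hxy)]
  have hsub : Ioo y x ⊆ Ioo (0 : ℝ) 1 := Ioo_subset_Ioo hy.1 hx.2
  calc (x - y) ^ 2 / (2 * (x * Ψ x)) = ∫ σ in Ioo y x, (σ - y) * (x * Ψ x)⁻¹ := by
        rw [integral_mul_const, ← integral_Ioc_eq_integral_Ioo,
          ← intervalIntegral.integral_of_le hxy,
          intervalIntegral.integral_comp_sub_right (fun z => z) y]
        simp
        field_simp
    _ ≤ ∫ σ in Ioo y x, F σ := by
        refine setIntegral_mono_on ?_ (hFint.mono_set hsub) measurableSet_Ioo fun σ hσ => ?_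
        · exact (Continuous.integrableOn_Icc (by fun_prop)).mono_set Ioo_subset_Icc_self
        · have hσ' := hsub hσ
          rw [hlt σ hσ' hσ.2, max_eq_left (by linarith [hσ.1])]
          refine mul_le_mul_of_nonneg_left ?_ (by linarith [hσ.1])
          exact inv_anti₀ (mul_pos hσ'.1 (hpos σ ⟨hσ'.1, hσ'.2.le⟩))
            (hinc ⟨hσ'.1, hσ'.2.le⟩ hx hσ.2.le)
    _ ≤ ∫ σ in Ioo (0 : ℝ) 1, F σ :=
        setIntegral_mono_set hFint ((ae_restrict_mem measurableSet_Ioo).mono hnn)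
          hsub.eventuallyLE

end Convexity

section Jensen

variable {ι : Type*} [Fintype ι] {α : ι → ℝ}

lemma sum_mul_abs_sub_mean (h1 : ∑ k, α k = 1) (x : ι → ℝ) :
    ∑ k, α k * |x k - ∑ j, α j * x j| = 2 * ∑ k, α k * max ((∑ j, α j * x j) - x k) 0 := by
  set X := ∑ j, α j * x j with hX
  have h2 : ∑ k, α k * (x k - X) = 0 := by
    simp only [mul_sub, Finset.sum_sub_distrib, ← Finset.sum_mul, h1, ← hX]
    ring
  rw [Finset.mul_sum, ← sub_eq_zero, ← Finset.sum_sub_distrib]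
  refine (Finset.sum_congr rfl fun k _ => ?_).trans h2
  rcases le_total (x k) X with h | h
  · rw [abs_of_nonpos (by linarith), max_eq_left (by linarith)]
    ring
  · rw [abs_of_nonneg (by linarith), max_eq_right (by linarith)]
    ring

lemma sq_sum_mul_le (h0 : ∀ k, 0 ≤ α k) (h1 : ∑ k, α k = 1) (x : ι → ℝ) :
    (∑ k, α k * x k) ^ 2 ≤ ∑ k, α k * x k ^ 2 := by
  simpa using (even_two.convexOn_pow (𝕜 := ℝ)).map_sum_le (t := Finset.univ) (w := α) (p := x)
    (fun k _ => h0 k) h1 (fun _ _ => mem_univ _)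

lemma mean_mem_Icc (h0 : ∀ k, 0 ≤ α k) (h1 : ∑ k, α k = 1) {x : ι → ℝ}
    (hx : ∀ k, x k ∈ Icc (0 : ℝ) 1) : ∑ k, α k * x k ∈ Icc (0 : ℝ) 1 :=
  (convex_Icc (0 : ℝ) 1).sum_mem (fun k _ => h0 k) h1 fun k _ => hx k

variable {Ψ : ℝ → ℝ}

/-- Quantitative Jensen inequality for `m`. -/
lemma jensen_gap_mFun (hpos : ∀ s ∈ Ioc (0 : ℝ) 1, 0 < Ψ s)
    (hnorm : (∫ s in Ioo (0 : ℝ) 1, (s * Ψ s)⁻¹) = 1)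
    (hinc : MonotoneOn (fun s => s * Ψ s) (Ioc (0 : ℝ) 1))
    (h0 : ∀ k, 0 ≤ α k) (h1 : ∑ k, α k = 1) {x : ι → ℝ} (hx : ∀ k, x k ∈ Icc (0 : ℝ) 1)
    {X : ℝ} (hX : X = ∑ k, α k * x k) :
    0 ≤ (∑ k, α k * mFun Ψ (x k)) - mFun Ψ X ∧
      (∑ k, α k * |x k - X|) ^ 2 ≤
        8 * (if X = 0 then 0 else X * Ψ X) * ((∑ k, α k * mFun Ψ (x k)) - mFun Ψ X) := by
  have hXm : X ∈ Icc (0 : ℝ) 1 := hX ▸ mean_mem_Icc h0 h1 hx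
  have hD : ∑ k, α k * |x k - X| = 2 * ∑ k, α k * max (X - x k) 0 := by
    rw [hX]
    exact sum_mul_abs_sub_mean h1 x
  by_cases hX0 : X = 0
  · refine ⟨?_, ?_⟩
    · rw [hX0, mFun_zero, sub_zero]
      exact Finset.sum_nonneg fun k _ => mul_nonneg (h0 k) (mFun_nonneg hpos hnorm (hx k))
    · rw [hD, hX0]
      have : ∀ k, max (-x k) 0 = 0 := fun k => max_eq_right (by linarith [(hx k).1])
      simp [this]
  · have hXp : X ∈ Ioc (0 : ℝ) 1 := ⟨lt_of_le_of_ne hXm.1 (Ne.symm hX0), hXm.2⟩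
    have hφ : 0 < X * Ψ X := mul_pos hXp.1 (hpos X hXp)
    obtain ⟨p, hp⟩ := exists_subgradient_mFun hpos hnorm hinc hXp
    have hkey : (∑ k, α k * (max (X - x k) 0) ^ 2) / (2 * (X * Ψ X)) ≤
        (∑ k, α k * mFun Ψ (x k)) - mFun Ψ X := by
      calc _ = ∑ k, α k * ((max (X - x k) 0) ^ 2 / (2 * (X * Ψ X))) := by
            rw [Finset.sum_div]
            exact Finset.sum_congr rfl fun k _ => mul_div_assoc _ _ _
        _ ≤ ∑ k, α k * (mFun Ψ (x k) - mFun Ψ X - p * (x k - X)) :=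
            Finset.sum_le_sum fun k _ => mul_le_mul_of_nonneg_left (hp _ (hx k)) (h0 k)
        _ = ∑ k, (α k * mFun Ψ (x k) - α k * mFun Ψ X - p * (α k * x k) + p * X * α k) :=
            Finset.sum_congr rfl fun k _ => by ring
        _ = _ := by
            rw [Finset.sum_add_distrib, Finset.sum_sub_distrib, Finset.sum_sub_distrib,
              ← Finset.sum_mul, ← Finset.mul_sum, ← Finset.mul_sum, h1, ← hX]
            ring
    have hsq := sq_sum_mul_le h0 h1 fun k => max (X - x k) 0
    have hnn : 0 ≤ ∑ k, α k * (max (X - x k) 0) ^ 2 :=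
      Finset.sum_nonneg fun k _ => mul_nonneg (h0 k) (sq_nonneg _)
    refine ⟨le_trans (by positivity) hkey, ?_⟩
    rw [div_le_iff₀ (by positivity)] at hkey
    rw [if_neg hX0, hD]
    nlinarith

end Jensen

/-- Cauchy–Schwarz for functions related by a pointwise quadratic bound. -/
lemma sq_integral_le_of_sq_le {X : Type*} [MeasurableSpace X] {μ : Measure X}
    {d p g : X → ℝ} (hd : Integrable d μ) (hp : Integrable p μ) (hg : Integrable g μ)
    (hp0 : ∀ᵐ t ∂μ, 0 ≤ p t) (hg0 : ∀ᵐ t ∂μ, 0 ≤ g t) (h : ∀ᵐ t ∂μ, d t ^ 2 ≤ p t * g t) :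
    (∫ t, d t ∂μ) ^ 2 ≤ (∫ t, p t ∂μ) * ∫ t, g t ∂μ := by
  have key : ∀ θ : ℝ, 0 ≤ (∫ t, p t ∂μ) * (θ * θ) + (-2 * ∫ t, d t ∂μ) * θ + ∫ t, g t ∂μ := by
    intro θ
    have e : (∫ t, p t ∂μ) * (θ * θ) + (-2 * ∫ t, d t ∂μ) * θ + ∫ t, g t ∂μ =
        ∫ t, (p t * (θ * θ) + d t * (-2 * θ) + g t) ∂μ := by
      have h1 : ∫ t, (p t * (θ * θ) + d t * (-2 * θ)) ∂μ = _ :=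
        integral_add (hp.mul_const (θ * θ)) (hd.mul_const (-2 * θ))
      have h2 : ∫ t, (p t * (θ * θ) + d t * (-2 * θ) + g t) ∂μ = _ :=
        integral_add ((hp.mul_const (θ * θ)).add (hd.mul_const (-2 * θ))) hg
      rw [h2]
      rw [h1, integral_mul_const, integral_mul_const]
      ring
    rw [e]
    refine integral_nonneg_of_ae ?_
    filter_upwards [hp0, hg0, h] with t h1 h2 h3
    simp only [Pi.zero_apply]
    rcases h1.eq_or_lt with h1 | h1
    · have : d t = 0 := by
        rw [← h1, zero_mul] at h3
        exact pow_eq_zero_iff (two_ne_zero) |>.1 (le_antisymm h3 (sq_nonneg _))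
      rw [← h1, this]
      simpa using h2
    · have : 0 ≤ p t * (p t * (θ * θ) + d t * (-2 * θ) + g t) := by
        nlinarith [sq_nonneg (p t * θ - d t)]
      exact nonneg_of_mul_nonneg_right this h1
  have := discrim_le_zero key
  rw [discrim] at this
  nlinarith

lemma gap_sq_div_eq {ι : Type*} [Fintype ι] {α f v : ι → ℝ} {u : ℝ} (hv : ∀ k, 0 < v k)
    {l : ℝ} (hl : ∑ k, α k * f k = l * u) :
    -((∑ k, α k * f k) ^ 2 / u) + ∑ k, α k * (f k ^ 2 / v k) =
      (∑ k, α k * ((f k - l * v k) ^ 2 / v k)) + l ^ 2 * (u - ∑ k, α k * v k) := by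
  have e : ∑ k, α k * ((f k - l * v k) ^ 2 / v k) =
      ∑ k, (α k * (f k ^ 2 / v k) - 2 * l * (α k * f k) + l ^ 2 * (α k * v k)) := by
    refine Finset.sum_congr rfl fun k _ => ?_
    have := (hv k).ne'
    field_simp
    ring
  rw [e, Finset.sum_add_distrib, Finset.sum_sub_distrib, ← Finset.mul_sum, ← Finset.mul_sum, hl]
  field_simp
  ring

lemma gap_sq_div_nonneg {ι : Type*} [Fintype ι] {α f v : ι → ℝ} {u : ℝ}
    (h0 : ∀ k, 0 ≤ α k) (hv : ∀ k, 0 < v k) (hu : 0 < u) (hconc : ∑ k, α k * v k ≤ u) :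
    0 ≤ -((∑ k, α k * f k) ^ 2 / u) + ∑ k, α k * (f k ^ 2 / v k) := by
  rw [gap_sq_div_eq hv (div_mul_cancel₀ _ hu.ne').symm]
  exact add_nonneg (Finset.sum_nonneg fun k _ =>
    mul_nonneg (h0 k) (div_nonneg (sq_nonneg _) (hv k).le))
    (mul_nonneg (sq_nonneg _) (sub_nonneg.2 hconc))

/-- Lower bound for the gap in the convexity of `f² / u` along a concave perturbation of `u`. -/
lemma gap_sq_div_ge {ι : Type*} [Fintype ι] {α f v : ι → ℝ} {u n K : ℝ}
    (h0 : ∀ k, 0 ≤ α k) (hv : ∀ k, 0 < v k) (hu : 0 < u) (hn : 0 < n) (hK : 0 ≤ K)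
    (hconc : ∑ k, α k * v k ≤ u) (huK : u ≤ K * n)
    (hdiff : (∑ k, α k * |v k - u|) ^ 2 ≤ 32 * n * (u - ∑ k, α k * v k)) :
    (∑ k, α k * |f k - ∑ j, α j * f j|) ^ 2 / n ≤
      (2 * K + 64) * (-((∑ k, α k * f k) ^ 2 / u) + ∑ k, α k * (f k ^ 2 / v k)) := by
  set F := ∑ k, α k * f k with hF
  set V := ∑ k, α k * v k with hV
  set l := F / u with hl
  have hFl : F = l * u := by rw [hl]; field_simp
  have hgap := gap_sq_div_eq hv hFl
  rw [← hF, ← hV] at hgap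
  set G := ∑ k, α k * ((f k - l * v k) ^ 2 / v k) with hG
  have hG0 : 0 ≤ G := Finset.sum_nonneg fun k _ =>
    mul_nonneg (h0 k) (div_nonneg (sq_nonneg _) (hv k).le)
  set A := ∑ k, α k * |f k - l * v k| with hA
  set B := ∑ k, α k * |v k - u| with hB
  have hA2 : A ^ 2 ≤ V * G := by
    refine Finset.sum_sq_le_sum_mul_sum_of_sq_le_mul _
      (fun k _ => mul_nonneg (h0 k) (hv k).le)
      (fun k _ => mul_nonneg (h0 k) (div_nonneg (sq_nonneg _) (hv k).le)) fun k _ => ?_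
    have := (hv k).ne'
    rw [mul_pow, sq_abs]
    refine le_of_eq ?_
    field_simp
  have hS : ∑ k, α k * |f k - F| ≤ A + |l| * B := by
    rw [hA, hB, Finset.mul_sum, ← Finset.sum_add_distrib]
    refine Finset.sum_le_sum fun k _ => ?_
    have : |f k - F| ≤ |f k - l * v k| + |l| * |v k - u| := by
      rw [← abs_mul, hFl]
      refine le_trans (le_of_eq ?_) (abs_add_le _ _)
      congr 1
      ring
    nlinarith [h0 k]
  have hS0 : 0 ≤ ∑ k, α k * |f k - F| :=
    Finset.sum_nonneg fun k _ => mul_nonneg (h0 k) (abs_nonneg _)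
  have hVG : V * G ≤ K * n * G := mul_le_mul_of_nonneg_right (hconc.trans huK) hG0
  have hlB : (|l| * B) ^ 2 ≤ 32 * n * (l ^ 2 * (u - V)) := by
    rw [mul_pow, sq_abs]
    nlinarith [sq_nonneg l]
  have hE0 : 0 ≤ l ^ 2 * (u - V) := mul_nonneg (sq_nonneg _) (by linarith)
  rw [hgap, div_le_iff₀ hn]
  calc _ ≤ (A + |l| * B) ^ 2 := pow_le_pow_left₀ hS0 hS 2
    _ ≤ 2 * A ^ 2 + 2 * (|l| * B) ^ 2 := by nlinarith [sq_nonneg (A - |l| * B)]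
    _ ≤ 2 * (K * n * G) + 64 * n * (l ^ 2 * (u - V)) := by linarith
    _ ≤ _ := by
      have h2 : 0 ≤ n * G := by positivity
      have h3 : 0 ≤ K * n * (l ^ 2 * (u - V)) := by positivity
      nlinarith

section DistFun

variable {Ψ N : ℝ → ℝ}

lemma isDistFun_mean {ι : Type*} [Fintype ι] {α : ι → ℝ} {N : ι → ℝ → ℝ}
    (h0 : ∀ k, 0 ≤ α k) (h1 : ∑ k, α k = 1) (hN : ∀ k, IsDistFun (N k)) :
    IsDistFun fun t => ∑ k, α k * N k t :=
  ⟨fun _ hs _ ht hst => Finset.sum_le_sum fun k _ =>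
      mul_le_mul_of_nonneg_left ((hN k).1 hs ht hst) (h0 k),
    fun t ht => mean_mem_Icc h0 h1 fun k => (hN k).2.1 t ht,
    integrable_finsetSum _ fun k _ => (hN k).2.2.const_mul _⟩

lemma IsDistFun.integrableOn_mFun (hpos : ∀ s ∈ Ioc (0 : ℝ) 1, 0 < Ψ s)
    (hnorm : (∫ s in Ioo (0 : ℝ) 1, (s * Ψ s)⁻¹) = 1)
    (hN : IsDistFun N) :
    IntegrableOn (fun t => mFun Ψ (N t)) (Ioi 0) := by
  refine Integrable.mono' hN.2.2 ?_ ?_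
  · refine (aemeasurable_restrict_of_antitoneOn measurableSet_Ioi ?_).aestronglyMeasurable
    intro s hs t ht hst
    have hs' : (0 : ℝ) ≤ s := (mem_Ioi.1 hs).le
    have ht' : (0 : ℝ) ≤ t := (mem_Ioi.1 ht).le
    exact mFun_mono hpos hnorm (hN.2.1 s hs') (hN.2.1 t ht') (hN.1 hs' ht' hst)
  · filter_upwards [ae_restrict_mem measurableSet_Ioi] with t ht
    have h := hN.2.1 t (mem_Ioi.1 ht).le
    rw [Real.norm_eq_abs, abs_of_nonneg (mFun_nonneg hpos hnorm h)]
    exact mFun_le_self hpos hnorm h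

lemma IsDistFun.integrableOn_uFun (hpos : ∀ s ∈ Ioc (0 : ℝ) 1, 0 < Ψ s)
    (hnorm : (∫ s in Ioo (0 : ℝ) 1, (s * Ψ s)⁻¹) = 1)
    (hN : IsDistFun N) :
    IntegrableOn (fun t => 2 * N t - mFun Ψ (N t)) (Ioi 0) :=
  (hN.2.2.const_mul 2).sub (hN.integrableOn_mFun hpos hnorm)

lemma IsDistFun.integral_le_uFun (hpos : ∀ s ∈ Ioc (0 : ℝ) 1, 0 < Ψ s)
    (hnorm : (∫ s in Ioo (0 : ℝ) 1, (s * Ψ s)⁻¹) = 1)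
    (hN : IsDistFun N) : ∫ t in Ioi (0 : ℝ), N t ≤ uFun Ψ N :=
  setIntegral_mono_on hN.2.2 (hN.integrableOn_uFun hpos hnorm) measurableSet_Ioi fun t ht => by
    linarith [mFun_le_self hpos hnorm (hN.2.1 t (mem_Ioi.1 ht).le)]

lemma IsDistFun.uFun_le (hpos : ∀ s ∈ Ioc (0 : ℝ) 1, 0 < Ψ s)
    (hnorm : (∫ s in Ioo (0 : ℝ) 1, (s * Ψ s)⁻¹) = 1)
    (hN : IsDistFun N) : uFun Ψ N ≤ 2 * ∫ t in Ioi (0 : ℝ), N t := by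
  rw [← integral_const_mul]
  exact setIntegral_mono_on (hN.integrableOn_uFun hpos hnorm) (hN.2.2.const_mul 2)
    measurableSet_Ioi fun t ht => by
      linarith [mFun_nonneg hpos hnorm (hN.2.1 t (mem_Ioi.1 ht).le)]

lemma IsDistFun.integrand_nPsi_nonneg (hpos : ∀ s ∈ Ioc (0 : ℝ) 1, 0 < Ψ s)
    (hN : IsDistFun N) {t : ℝ} (ht : 0 ≤ t) :
    0 ≤ if N t = 0 then 0 else N t * Ψ (N t) := by
  have h := hN.2.1 t ht
  split_ifs with h0
  · rfl
  · exact mul_nonneg h.1 (hpos _ ⟨lt_of_le_of_ne h.1 (Ne.symm h0), h.2⟩).le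

lemma IsDistFun.mul_integral_le_nPsi (hdec : AntitoneOn Ψ (Ioc (0 : ℝ) 1)) (hN : IsDistFun N)
    (hint : IntegrableOn (fun t => if N t = 0 then 0 else N t * Ψ (N t)) (Ioi (0 : ℝ))) :
    Ψ 1 * ∫ t in Ioi (0 : ℝ), N t ≤ nPsi Ψ N := by
  rw [← integral_const_mul]
  refine setIntegral_mono_on (hN.2.2.const_mul _) hint measurableSet_Ioi fun t ht => ?_
  have h := hN.2.1 t (mem_Ioi.1 ht).le
  split_ifs with h0
  · simp [h0]
  · rw [mul_comm]
    have hp : 0 < N t := lt_of_le_of_ne h.1 (Ne.symm h0)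
    exact mul_le_mul_of_nonneg_left (hdec ⟨hp, h.2⟩ (by simp) h.2) h.1

lemma sum_abs_uFun_sub_le (hpos : ∀ s ∈ Ioc (0 : ℝ) 1, 0 < Ψ s)
    (hnorm : (∫ s in Ioo (0 : ℝ) 1, (s * Ψ s)⁻¹) = 1)
    {ι : Type*} [Fintype ι] {α : ι → ℝ} {N : ι → ℝ → ℝ} {M : ℝ → ℝ}
    (h0 : ∀ k, 0 ≤ α k) (hN : ∀ k, IsDistFun (N k)) (hM : IsDistFun M) :
    ∑ k, α k * |uFun Ψ (N k) - uFun Ψ M| ≤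
      2 * ∫ t in Ioi (0 : ℝ), ∑ k, α k * |N k t - M t| := by
  have hi : ∀ k, IntegrableOn (fun t => |N k t - M t|) (Ioi (0 : ℝ)) := fun k =>
    ((hN k).2.2.sub hM.2.2).abs
  rw [integral_finsetSum _ fun k _ => (hi k).const_mul _, Finset.mul_sum]
  refine Finset.sum_le_sum fun k _ => ?_
  rw [integral_const_mul, mul_left_comm]
  refine mul_le_mul_of_nonneg_left ?_ (h0 k)
  rw [uFun, uFun, ← integral_sub ((hN k).integrableOn_uFun hpos hnorm)
    (hM.integrableOn_uFun hpos hnorm), ← integral_const_mul]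
  refine (abs_integral_le_integral_abs).trans ?_
  exact setIntegral_mono_on (((hN k).integrableOn_uFun hpos hnorm).sub
    (hM.integrableOn_uFun hpos hnorm)).abs ((hi k).const_mul 2) measurableSet_Ioi fun t ht =>
      abs_sub_mFun_le hpos hnorm ((hN k).2.1 t (mem_Ioi.1 ht).le) (hM.2.1 t (mem_Ioi.1 ht).le)

lemma uFun_mean_sub (hpos : ∀ s ∈ Ioc (0 : ℝ) 1, 0 < Ψ s)
    (hnorm : (∫ s in Ioo (0 : ℝ) 1, (s * Ψ s)⁻¹) = 1)
    {ι : Type*} [Fintype ι] {α : ι → ℝ} {N : ι → ℝ → ℝ}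
    (h0 : ∀ k, 0 ≤ α k) (h1 : ∑ k, α k = 1) (hN : ∀ k, IsDistFun (N k)) :
    uFun Ψ (fun t => ∑ k, α k * N k t) - ∑ k, α k * uFun Ψ (N k) =
      ∫ t in Ioi (0 : ℝ), ((∑ k, α k * mFun Ψ (N k t)) - mFun Ψ (∑ k, α k * N k t)) := by
  have hM := isDistFun_mean h0 h1 hN
  have hi : ∀ k, IntegrableOn (fun t => α k * (2 * N k t - mFun Ψ (N k t))) (Ioi (0 : ℝ)) :=
    fun k => ((hN k).integrableOn_uFun hpos hnorm).const_mul _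
  have e : ∑ k, α k * uFun Ψ (N k) =
      ∫ t in Ioi (0 : ℝ), ∑ k, α k * (2 * N k t - mFun Ψ (N k t)) := by
    rw [integral_finsetSum _ fun k _ => hi k]
    exact Finset.sum_congr rfl fun k _ => by rw [integral_const_mul, uFun]
  rw [e, uFun, ← integral_sub (hM.integrableOn_uFun hpos hnorm)
    (integrable_finsetSum _ fun k _ => hi k)]
  congr 1
  ext t
  simp only [mul_sub, Finset.sum_sub_distrib, Finset.mul_sum]
  rw [Finset.sum_congr rfl fun k _ => mul_left_comm (α k) 2 (N k t)]
  ring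

lemma sum_mul_uFun_le (hpos : ∀ s ∈ Ioc (0 : ℝ) 1, 0 < Ψ s)
    (hnorm : (∫ s in Ioo (0 : ℝ) 1, (s * Ψ s)⁻¹) = 1)
    {ι : Type*} [Fintype ι] {α : ι → ℝ} {N : ι → ℝ → ℝ}
    (hinc : MonotoneOn (fun s => s * Ψ s) (Ioc (0 : ℝ) 1))
    (h0 : ∀ k, 0 ≤ α k) (h1 : ∑ k, α k = 1) (hN : ∀ k, IsDistFun (N k)) :
    ∑ k, α k * uFun Ψ (N k) ≤ uFun Ψ (fun t => ∑ k, α k * N k t) := by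
  rw [← sub_nonneg, uFun_mean_sub hpos hnorm h0 h1 hN]
  exact setIntegral_nonneg measurableSet_Ioi fun t ht =>
    (jensen_gap_mFun hpos hnorm hinc h0 h1 (fun k => (hN k).2.1 t (mem_Ioi.1 ht).le) rfl).1

lemma sq_sum_abs_uFun_sub_le (hpos : ∀ s ∈ Ioc (0 : ℝ) 1, 0 < Ψ s)
    (hnorm : (∫ s in Ioo (0 : ℝ) 1, (s * Ψ s)⁻¹) = 1)
    {ι : Type*} [Fintype ι] {α : ι → ℝ} {N : ι → ℝ → ℝ} {M : ℝ → ℝ}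
    (hinc : MonotoneOn (fun s => s * Ψ s) (Ioc (0 : ℝ) 1))
    (h0 : ∀ k, 0 ≤ α k) (h1 : ∑ k, α k = 1) (hN : ∀ k, IsDistFun (N k))
    (hMN : M = fun t => ∑ k, α k * N k t)
    (hint : IntegrableOn (fun t => if M t = 0 then 0 else M t * Ψ (M t)) (Ioi (0 : ℝ))) :
    (∑ k, α k * |uFun Ψ (N k) - uFun Ψ M|) ^ 2 ≤
      32 * nPsi Ψ M * (uFun Ψ M - ∑ k, α k * uFun Ψ (N k)) := by
  have hM : IsDistFun M := hMN ▸ isDistFun_mean h0 h1 hN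
  have hgap : ∀ t ∈ Ioi (0 : ℝ), _ := fun t ht =>
    jensen_gap_mFun hpos hnorm hinc h0 h1 (fun k => (hN k).2.1 t (mem_Ioi.1 ht).le)
      (congrFun hMN t)
  have hCS : (∫ t in Ioi (0 : ℝ), ∑ k, α k * |N k t - M t|) ^ 2 ≤
      (∫ t in Ioi (0 : ℝ), 8 * (if M t = 0 then 0 else M t * Ψ (M t))) *
        ∫ t in Ioi (0 : ℝ), ((∑ k, α k * mFun Ψ (N k t)) - mFun Ψ (M t)) := by
    refine sq_integral_le_of_sq_le
      (integrable_finsetSum _ fun k _ => (((hN k).2.2.sub hM.2.2).abs).const_mul _)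
      (hint.const_mul 8)
      ((integrable_finsetSum _ fun k _ =>
        ((hN k).integrableOn_mFun hpos hnorm).const_mul _).sub (hM.integrableOn_mFun hpos hnorm))
      ?_ ?_ ?_
    · filter_upwards [ae_restrict_mem measurableSet_Ioi] with t ht
      exact mul_nonneg (by norm_num) (hM.integrand_nPsi_nonneg hpos (mem_Ioi.1 ht).le)
    · filter_upwards [ae_restrict_mem measurableSet_Ioi] with t ht using (hgap t ht).1
    · filter_upwards [ae_restrict_mem measurableSet_Ioi] with t ht using (hgap t ht).2
  have hu := uFun_mean_sub hpos hnorm h0 h1 hN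
  rw [← hMN] at hu
  have hs := sum_abs_uFun_sub_le hpos hnorm h0 hN hM
  have hs0 : 0 ≤ ∑ k, α k * |uFun Ψ (N k) - uFun Ψ M| :=
    Finset.sum_nonneg fun k _ => mul_nonneg (h0 k) (abs_nonneg _)
  have hcongr : ∀ t, (∑ k, α k * mFun Ψ (N k t)) - mFun Ψ (M t) =
      (∑ k, α k * mFun Ψ (N k t)) - mFun Ψ (∑ k, α k * N k t) := fun t => by rw [hMN]
  simp only [hcongr] at hCS
  rw [integral_const_mul, ← hu] at hCS
  change _ ≤ 8 * nPsi Ψ M * _ at hCS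
  have := pow_le_pow_left₀ hs0 hs 2
  linarith [mul_pow 2 (∫ t in Ioi (0 : ℝ), ∑ k, α k * |N k t - M t|) 2]

end DistFun

/-- the `n`-point form (3.12) of the main Bellman inequality. -/
theorem statement7 (Ψ : ℝ → ℝ)
    (hΨpos : ∀ s ∈ Set.Ioc (0:ℝ) 1, 0 < Ψ s)
    (hΨdec : AntitoneOn Ψ (Set.Ioc (0:ℝ) 1))
    (hφinc : MonotoneOn (fun s => s * Ψ s) (Set.Ioc (0:ℝ) 1))
    (hnorm : (∫ s in Set.Ioo (0:ℝ) 1, (s * Ψ s)⁻¹) = 1) :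
    ∃ c : ℝ, 0 < c ∧
      ∀ (n : ℕ), 1 ≤ n →
        ∀ (α f : Fin n → ℝ) (N : Fin n → ℝ → ℝ),
          (∀ k, 0 ≤ α k) → (∑ k, α k) = 1 →
          (∀ k, IsDistFun (N k)) →
          (∀ k, 0 < ∫ t in Set.Ioi (0:ℝ), N k t) →
          c / 16 * (∑ k, α k * |f k - ∑ j, α j * f j|) ^ 2 /
              nPsi Ψ (fun t => ∑ k, α k * N k t) ≤
            -Btilde Ψ (∑ k, α k * f k) (fun t => ∑ k, α k * N k t) +
              ∑ k, α k * Btilde Ψ (f k) (N k) := by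
  have hΨ1 : 0 < Ψ 1 := hΨpos 1 (by simp)
  refine ⟨16 / (2 * (2 / Ψ 1) + 64), by positivity, ?_⟩
  intro n _ α f N h0 h1 hN hNpos
  set M : ℝ → ℝ := fun t => ∑ k, α k * N k t with hMN
  have hM : IsDistFun M := isDistFun_mean h0 h1 hN
  have hv : ∀ k, 0 < uFun Ψ (N k) := fun k =>
    (hNpos k).trans_le ((hN k).integral_le_uFun hΨpos hnorm)
  have hconc : ∑ k, α k * uFun Ψ (N k) ≤ uFun Ψ M :=
    sum_mul_uFun_le hΨpos hnorm hφinc h0 h1 hN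
  have hu : 0 < uFun Ψ M := by
    obtain ⟨k, -, hk⟩ : ∃ k ∈ Finset.univ, 0 < α k := by
      by_contra! h
      linarith [Finset.sum_nonpos h]
    refine lt_of_lt_of_le ?_ hconc
    exact Finset.sum_pos' (fun j _ => mul_nonneg (h0 j) (hv j).le)
      ⟨k, Finset.mem_univ _, mul_pos hk (hv k)⟩
  have hMpos : 0 < ∫ t in Ioi (0 : ℝ), M t := by linarith [hM.uFun_le hΨpos hnorm]
  simp only [Btilde]
  by_cases hint : IntegrableOn (fun t => if M t = 0 then 0 else M t * Ψ (M t)) (Ioi (0 : ℝ))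
  · have hle := hM.mul_integral_le_nPsi hΨdec hint
    have hn : 0 < nPsi Ψ M := (mul_pos hΨ1 hMpos).trans_le hle
    have huK : uFun Ψ M ≤ 2 / Ψ 1 * nPsi Ψ M := by
      refine (hM.uFun_le hΨpos hnorm).trans ?_
      rw [div_mul_eq_mul_div, le_div_iff₀ hΨ1]
      linarith
    have := gap_sq_div_ge (f := f) h0 hv hu hn (by positivity) hconc huK
      (sq_sum_abs_uFun_sub_le hΨpos hnorm hφinc h0 h1 hN hMN hint)
    rw [mul_div_assoc]
    refine (mul_le_mul_of_nonneg_left this (by positivity)).trans (le_of_eq ?_)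
    field_simp
  · have hn : nPsi Ψ M = 0 := integral_undef hint
    rw [hn, div_zero]
    exact gap_sq_div_nonneg h0 hv hu hconc
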